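/- arXiv:1609.01120 — 2 statements merged into one kernel-verified Lean document; each statement's English description precedes it below -/
import Mathlib

section
/- Let G be a connected loopless multigraph, q = p^d with p an odd prime. For each α : E(G) → 𝔽_q^*, let W*(α) be a minimum-cardinality nonempty subset W of V(G) with s(α, G/W) ≠ 0, and let r*(G,α) = |V(G)| − |W*(α)|. Then the number F_G(q) of nowhere-zero 𝔽_q-flows on G equals Σ_{α : E(G) → 𝔽_q^*} η(s(α, G/W*(α))) · (g(q)/q)^{r*(G,α)}, where η is the quadratic character and g(q) the quadratic Gaussian sum of 𝔽_q. -/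
open Finset in
/-- `u` and `v` are connected by edges in `T` (for the multigraph with origin `i`, terminus `f`). -/
def Connects {V E : Type} (i f : E → V) (T : Finset E) (u v : V) : Prop :=
  Relation.ReflTransGen
    (fun a b => ∃ e ∈ T, (i e = a ∧ f e = b) ∨ (i e = b ∧ f e = a)) u v

/-- `T` is (the edge set of) a spanning tree: connected and with `|V| - 1` edges. -/
def IsSpanningTree {V E : Type} [Fintype V] (i f : E → V) (T : Finset E) : Prop :=
  (∀ u v : V, Connects i f T u v) ∧ T.card + 1 = Fintype.card V

/-- The spanning-tree generating polynomial `s(α, G)`. -/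
noncomputable def treeSum {V E R : Type} [Fintype V] [Fintype E] [DecidableEq E]
    [CommRing R] (i f : E → V) (α : E → R) : R :=
  ∑ T ∈ @Finset.filter _ (fun T => IsSpanningTree i f T) (Classical.decPred _) Finset.univ,
    ∏ e ∈ T, α e

/-- The weighted Laplacian matrix of the multigraph. -/
def Lap {V E R : Type} [Fintype E] [DecidableEq V] [CommRing R]
    (i f : E → V) (α : E → R) : Matrix V V R := fun k j =>
  if k = j then ∑ e ∈ Finset.univ.filter (fun e => i e = k ∨ f e = k), α e
  else - ∑ e ∈ Finset.univ.filter (fun e => (i e = k ∧ f e = j) ∨ (i e = j ∧ f e = k)), α e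

/-- The projection of a vertex of `G` to a vertex of the contracted graph `G/W`. -/
def proj {V : Type} [DecidableEq V] (W : Finset V) (v : V) : Option {v : V // v ∉ W} :=
  if h : v ∈ W then none else some ⟨v, h⟩

/-- `s(α, G/W)`: the spanning-tree generating polynomial of the contraction of `W` in `G`
(the contracted graph has vertex set `Option {v // v ∉ W}`, with `none` the contracted vertex,
and its edges are the edges of `G` not internal to `W`). -/
noncomputable def sContr {V E R : Type} [Fintype V] [Fintype E] [DecidableEq V] [DecidableEq E]
    [CommRing R] (i f : E → V) (W : Finset V) (α : E → R) : R :=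
  treeSum (fun e : {e : E // ¬(i e ∈ W ∧ f e ∈ W)} => proj W (i e.1))
    (fun e => proj W (f e.1)) (fun e => α e.1)

/-- The incidence sign `ε_{v,e}`, as an element of the coefficient ring. -/
def eps {V E R : Type} [DecidableEq V] [CommRing R] (i f : E → V) (v : V) (e : E) : R :=
  if i e = v then -1 else if f e = v then 1 else 0

/-- The number of nowhere-zero `F`-flows on the multigraph. -/
noncomputable def flowCount {V E : Type} [Fintype E] [DecidableEq V]
    (F : Type) [Field F] (i f : E → V) : ℕ :=
  Nat.card {k : E → F // (∀ e, k e ≠ 0) ∧ ∀ v : V, ∑ e : E, eps i f v e * k e = 0}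

/-- The quadratic Gaussian sum `g(q)` of the finite field `F` (w.r.t. the additive
character `χ`); the quadratic character vanishes at `0`, so we may sum over all of `F`. -/
noncomputable def gSum (F : Type) [Field F] [Fintype F] [DecidableEq F]
    (χ : AddChar F ℂ) : ℂ :=
  ∑ x : F, ((quadraticChar F x : ℤ) : ℂ) * χ x

namespace FlowCount

open Finset Matrix

section CauchyBinet

variable {n E R : Type*} [Fintype n] [DecidableEq n] [CommRing R]

/-- Multilinear expansion of the determinant of a sum of rank-one matrices. -/
theorem det_sum_rankOne (S : Finset E) (a b : E → n → R) :
    det (of fun u v => ∑ e ∈ S, a e u * b e v) =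
      ∑ p ∈ Fintype.piFinset fun _ : n => S, (∏ u, a (p u) u) * det (of fun u => b (p u)) := by
  have h : (of fun u v => ∑ e ∈ S, a e u * b e v : Matrix n n R) =
      fun u => ∑ e ∈ S, a e u • b e := by
    ext u v
    simp [Finset.sum_apply]
  change detRowAlternating _ = _
  rw [h]
  have := (detRowAlternating (n := n) (R := R)).toMultilinearMap.map_sum_finset
    (fun u e => a e u • b e) (fun _ => S)
  refine this.trans (sum_congr rfl fun p _ => ?_)
  exact (detRowAlternating (n := n) (R := R)).toMultilinearMap.map_smul_univ _ _

/-- The Cauchy–Binet formula, for sums of rank-one matrices. -/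
theorem det_sum_rankOne_eq_sum_powersetCard [Fintype E] [DecidableEq E] (a b : E → n → R) :
    det (of fun u v => ∑ e, a e u * b e v) =
      ∑ T ∈ powersetCard (Fintype.card n) univ, det (of fun u v => ∑ e ∈ T, a e u * b e v) := by
  have hz : ∀ p : n → E, ¬ Function.Injective p →
      (∏ u, a (p u) u) * det (of fun u => b (p u)) = 0 := by
    intro p hp
    simp only [Function.Injective, not_forall] at hp
    obtain ⟨x, y, hxy, hne⟩ := hp
    rw [det_zero_of_row_eq hne (by ext v; simp [hxy]), mul_zero]
  have hmem : ∀ p ∈ (univ : Finset (n → E)).filter Function.Injective,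
      univ.image p ∈ powersetCard (Fintype.card n) (univ : Finset E) := by
    intro p hp
    rw [mem_powersetCard_univ, card_image_of_injective _ (mem_filter.1 hp).2, card_univ]
  rw [det_sum_rankOne, Fintype.piFinset_univ,
    ← sum_filter_of_ne (p := Function.Injective) (fun p _ h => not_not.1 fun h' => h (hz p h')),
    ← sum_fiberwise_of_maps_to hmem]
  refine sum_congr rfl fun T hT => ?_
  rw [det_sum_rankOne]
  refine sum_subset (fun p hp => ?_) fun p hp hp' => hz p fun hinj => hp' ?_
  · rw [Fintype.mem_piFinset]
    intro u
    rw [← (mem_filter.1 hp).2]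
    exact mem_image_of_mem _ (mem_univ _)
  · refine mem_filter.2 ⟨mem_filter.2 ⟨mem_univ _, hinj⟩, eq_of_subset_of_card_le ?_ ?_⟩
    · intro e he
      obtain ⟨u, -, rfl⟩ := mem_image.1 he
      exact Fintype.mem_piFinset.1 hp u
    · rw [card_image_of_injective _ hinj, card_univ, mem_powersetCard_univ.1 hT]

end CauchyBinet

section MatrixTree

variable {U E : Type} [DecidableEq U]

/-- The standard basis vector of a vertex, zero at the root `none`. -/
def vertexVec (R : Type*) [CommRing R] : Option U → U → R
  | none => 0
  | some u => Pi.single u 1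

/-- The column of `e` in the reduced incidence matrix. -/
def redIncidence (R : Type*) [CommRing R] (i f : E → Option U) (e : E) : U → R :=
  vertexVec R (f e) - vertexVec R (i e)

theorem map_redIncidence (R : Type*) [CommRing R] (i f : E → Option U) (e : E) (u : U) :
    ((redIncidence ℤ i f e u : ℤ) : R) = redIncidence R i f e u := by
  have h : ∀ o : Option U, ((vertexVec ℤ o u : ℤ) : R) = vertexVec R o u := by
    rintro (_ | w)
    · simp [vertexVec]
    · simp [vertexVec, Pi.single_apply]
  simp [redIncidence, h]

variable [Fintype U]

theorem sum_vertexVec_mul (R : Type*) [CommRing R] (X : Option U → R) (h0 : X none = 0)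
    (o : Option U) : ∑ u, vertexVec R o u * X (some u) = X o := by
  cases o with
  | none => simp [vertexVec, h0]
  | some w => simp [vertexVec, Pi.single_apply]

theorem connects_symm {V : Type} {i f : E → V} {T : Finset E} {u v : V}
    (h : Connects i f T u v) : Connects i f T v u := by
  induction h with
  | refl => exact Relation.ReflTransGen.refl
  | tail _ h ih =>
    obtain ⟨e, he, h⟩ := h
    exact Relation.ReflTransGen.head ⟨e, he, h.symm⟩ ih

theorem isUnit_det_redIncidence {i f : E → Option U} {T : Finset E} (p : U ≃ T)
    (hc : ∀ u v, Connects i f T u v) :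
    IsUnit (det (of fun x => redIncidence ℤ i f (p x))) := by
  set M : Matrix U U ℤ := of fun x => redIncidence ℤ i f (p x)
  have key : ∀ {a c}, Connects i f T a c →
      vertexVec ℤ c - vertexVec ℤ a ∈ Submodule.span ℤ (Set.range M.row) := by
    intro a c h
    induction h with
    | refl => simp
    | @tail b c _ h ih =>
      obtain ⟨e, he, h⟩ := h
      have hmem : redIncidence ℤ i f e ∈ Submodule.span ℤ (Set.range M.row) := by
        refine Submodule.subset_span ⟨p.symm ⟨e, he⟩, ?_⟩
        ext u
        simp [M, Matrix.row]
      have hstep : vertexVec ℤ c - vertexVec ℤ b ∈ Submodule.span ℤ (Set.range M.row) := by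
        rcases h with ⟨rfl, rfl⟩ | ⟨rfl, rfl⟩
        · exact hmem
        · rw [← neg_sub]
          exact Submodule.neg_mem _ hmem
      simpa using Submodule.add_mem _ hstep ih
  rw [← isUnit_iff_isUnit_det, ← vecMul_surjective_iff_isUnit]
  suffices h : LinearMap.range M.vecMulLinear = ⊤ from LinearMap.range_eq_top.1 h
  rw [range_vecMulLinear, eq_top_iff, ← (Pi.basisFun ℤ U).span_eq, Submodule.span_le]
  rintro _ ⟨u, rfl⟩
  simpa [vertexVec] using key (hc none (some u))

theorem det_redIncidence_eq_zero {i f : E → Option U} {T : Finset E} (p : U ≃ T)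
    (hc : ¬ ∀ u v, Connects i f T u v) :
    det (of fun x => redIncidence ℤ i f (p x)) = 0 := by
  classical
  obtain ⟨w, hw⟩ : ∃ w, ¬ Connects i f T none w := by
    by_contra! h
    exact hc fun u v => Relation.ReflTransGen.trans (connects_symm (h u)) (h v)
  obtain ⟨u, rfl⟩ : ∃ u, w = some u :=
    Option.ne_none_iff_exists'.1 fun h => hw (h ▸ Relation.ReflTransGen.refl)
  let X : Option U → ℤ := fun o => if Connects i f T none o then 0 else 1
  have h0 : X none = 0 := if_pos Relation.ReflTransGen.refl
  refine exists_mulVec_eq_zero_iff.1 ⟨fun v => X (some v), fun h => ?_, ?_⟩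
  · simpa [X, hw] using congrFun h u
  · ext x
    have hX : X (f (p x)) = X (i (p x)) := by
      have : Connects i f T none (f (p x)) ↔ Connects i f T none (i (p x)) :=
        ⟨fun h => h.tail ⟨p x, (p x).2, Or.inr ⟨rfl, rfl⟩⟩,
          fun h => h.tail ⟨p x, (p x).2, Or.inl ⟨rfl, rfl⟩⟩⟩
      simp [X, this]
    simp only [mulVec, dotProduct, of_apply, redIncidence, Pi.sub_apply, sub_mul,
      sum_sub_distrib, sum_vertexVec_mul ℤ X h0, hX, sub_self, Pi.zero_apply]

/-- The weighted matrix-tree theorem, for a multigraph rooted at `none`. -/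
theorem treeSum_eq_det {R : Type} [CommRing R] [Fintype E] [DecidableEq E]
    (i f : E → Option U) (α : E → R) :
    treeSum i f α =
      det (of fun u v => ∑ e, α e * redIncidence R i f e u * redIncidence R i f e v) := by
  classical
  rw [det_sum_rankOne_eq_sum_powersetCard (fun e u => α e * redIncidence R i f e u), treeSum]
  have hfilter : (@Finset.filter _ (fun T => IsSpanningTree i f T) (Classical.decPred _) univ) =
      (powersetCard (Fintype.card U) univ).filter fun T => ∀ u v, Connects i f T u v := by
    ext T
    simp [IsSpanningTree, and_comm]
  rw [hfilter, sum_filter]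
  refine sum_congr rfl fun T hT => ?_
  have hcard : Fintype.card U = Fintype.card T := by
    rw [Fintype.card_coe, mem_powersetCard_univ.1 hT]
  let p : U ≃ T := Fintype.equivOfCardEq hcard
  set M : Matrix U U ℤ := of fun x => redIncidence ℤ i f (p x) with hM
  have hdet : det (of fun u v => ∑ e ∈ T, α e * redIncidence R i f e u * redIncidence R i f e v) =
      (∏ e ∈ T, α e) * ((M.det ^ 2 : ℤ) : R) := by
    have : (of fun u v => ∑ e ∈ T, α e * redIncidence R i f e u * redIncidence R i f e v) =
        (M.map (Int.castRingHom R))ᵀ * diagonal (fun x => α (p x)) * M.map (Int.castRingHom R) := by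
      ext u v
      rw [mul_apply, of_apply, ← sum_coe_sort, ← p.sum_comp]
      refine sum_congr rfl fun x _ => ?_
      simp only [mul_diagonal, transpose_apply, map_apply, hM, of_apply, eq_intCast,
        map_redIncidence]
      ring
    rw [this, det_mul, det_mul, det_transpose, det_diagonal, p.prod_comp (fun e : T => α e),
      prod_coe_sort, ← RingHom.mapMatrix_apply, ← RingHom.map_det, eq_intCast]
    push_cast
    ring
  rw [hdet]
  split_ifs with hc
  · rw [Int.isUnit_sq (isUnit_det_redIncidence p hc), Int.cast_one, mul_one]
  · rw [hM, det_redIncidence_eq_zero p hc]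
    simp

end MatrixTree

section Laplacian

variable {V E R : Type} [DecidableEq V] [CommRing R]

/-- The weighted Laplacian, written through the incidence matrix. -/
def laplacian [Fintype E] (i f : E → V) (α : E → R) : Matrix V V R :=
  of fun u v => ∑ e, α e * eps i f u e * eps i f v e

theorem eps_eq_sub {i f : E → V} (hl : ∀ e, i e ≠ f e) (v : V) (e : E) :
    (eps i f v e : R) = (if f e = v then 1 else 0) - if i e = v then 1 else 0 := by
  unfold eps
  split_ifs with h1 h2
  · exact absurd (h1.trans h2.symm) (hl e)
  all_goals simp

theorem transpose_laplacian [Fintype E] (i f : E → V) (α : E → R) :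
    (laplacian i f α)ᵀ = laplacian i f α := by
  ext u v
  simp only [laplacian, transpose_apply, of_apply, mul_right_comm]

theorem dotProduct_laplacian_mulVec [Fintype E] [Fintype V] (i f : E → V) (α : E → R) (x : V → R) :
    x ⬝ᵥ laplacian i f α *ᵥ x = ∑ e, α e * (∑ v, x v * eps i f v e) ^ 2 := by
  simp only [dotProduct, mulVec, laplacian, of_apply, sq, mul_sum, sum_mul]
  rw [sum_congr rfl fun u _ => sum_comm, sum_comm]
  refine sum_congr rfl fun e _ => sum_congr rfl fun u _ => sum_congr rfl fun v _ => ?_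
  ring

theorem det_laplacian_eq_zero [Fintype E] [Fintype V] [Nonempty V] [IsDomain R] {i f : E → V}
    (hl : ∀ e, i e ≠ f e) (α : E → R) : det (laplacian i f α) = 0 := by
  refine exists_mulVec_eq_zero_iff.1 ⟨1, one_ne_zero, ?_⟩
  ext u
  simp only [mulVec, dotProduct, laplacian, of_apply, Pi.one_apply, mul_one, Pi.zero_apply]
  rw [sum_comm]
  simp [← mul_sum, eps_eq_sub hl]

theorem vertexVec_proj (W : Finset V) (v : V) (u : {v // v ∉ W}) :
    vertexVec R (proj W v) u = if v = u.1 then 1 else 0 := by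
  unfold proj
  split_ifs with h h' h'
  · exact absurd (h' ▸ h) u.2
  · rfl
  · subst h'
    simp [vertexVec]
  · exact Pi.single_eq_of_ne (fun h => h' (congrArg Subtype.val h).symm) _

theorem sContr_eq_det [Fintype E] [Fintype V] [DecidableEq E] {i f : E → V} (hl : ∀ e, i e ≠ f e)
    (W : Finset V) (α : E → R) :
    sContr i f W α =
      det ((laplacian i f α).submatrix (Subtype.val : {v // v ∉ W} → V) Subtype.val) := by
  rw [sContr, treeSum_eq_det]
  congr 1
  ext u v
  simp only [laplacian, of_apply, submatrix_apply, redIncidence, Pi.sub_apply, vertexVec_proj]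
  simp only [← eps_eq_sub hl]
  refine (sum_subtype (univ.filter fun e => ¬(i e ∈ W ∧ f e ∈ W)) (by simp)
    (fun e => α e * eps i f u.1 e * eps i f v.1 e)).symm.trans
    (sum_filter_of_ne fun e _ h hW => h ?_)
  have hu : (eps i f u.1 e : R) = 0 := by
    rw [eps, if_neg fun h : i e = u.1 => u.2 (h ▸ hW.1),
      if_neg fun h : f e = u.1 => u.2 (h ▸ hW.2)]
  simp [hu]

end Laplacian

section SymmetricMatrix

variable {F : Type*} [Field F] {m n : Type*} [Fintype m] [DecidableEq m]

/-- A symmetric Schur complement vanishes if all principal minors properly containing the pivot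
block vanish. -/
theorem schur_eq_zero (A : Matrix m m F) (B : Matrix m n F)
    (D : Matrix n n F) (hA : Aᵀ = A) (hD : Dᵀ = D) (hdet : A.det ≠ 0)
    (hminor : ∀ (k : ℕ) (g : Fin (k + 1) → n), Function.Injective g →
      det ((fromBlocks A B Bᵀ D).submatrix (Sum.map id g) (Sum.map id g)) = 0) :
    D = Bᵀ * A⁻¹ * B := by
  let _ := A.invertibleOfIsUnitDet (isUnit_iff_ne_zero.2 hdet)
  set C := D - Bᵀ * A⁻¹ * B with hC
  have hCT : Cᵀ = C := by
    rw [hC, transpose_sub, transpose_mul, transpose_mul, transpose_transpose,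
      transpose_nonsing_inv, hA, hD, Matrix.mul_assoc]
  have hminor' : ∀ (k : ℕ) (g : Fin (k + 1) → n), Function.Injective g →
      det (C.submatrix g g) = 0 := by
    intro k g hg
    have h := hminor k g hg
    have hsub : (fromBlocks A B Bᵀ D).submatrix (Sum.map id g) (Sum.map id g) =
        fromBlocks A (B.submatrix id g) (Bᵀ.submatrix g id) (D.submatrix g g) := by
      ext (x | x) (y | y) <;> rfl
    rw [hsub, det_fromBlocks₁₁, invOf_eq_nonsing_inv] at h
    exact (mul_eq_zero.1 h).resolve_left hdet
  have hdiag : ∀ a, C a a = 0 := fun a => by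
    simpa using hminor' 0 (fun _ => a) fun x y _ => Subsingleton.elim (α := Fin 1) x y
  refine sub_eq_zero.1 (hC ▸ ?_)
  ext a b
  rcases eq_or_ne a b with rfl | hab
  · exact hdiag a
  · have h := hminor' 1 ![a, b] (by
      intro x y; fin_cases x <;> fin_cases y <;> simp [hab, hab.symm])
    have hs : C b a = C a b := congrFun (congrFun hCT a) b
    rw [det_fin_two] at h
    simpa [hdiag, hs] using h

/-- Symmetric matrices are congruent to diagonal ones in odd characteristic. -/
theorem exists_transpose_mul_mul_eq_diagonal [Fintype n] [DecidableEq n] (hF : ringChar F ≠ 2)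
    (A : Matrix n n F) (hA : Aᵀ = A) : ∃ P : Matrix n n F, IsUnit P ∧ ∃ w, Pᵀ * A * P = diagonal w := by
  have : Invertible (2 : F) := invertibleOfNonzero (Ring.two_ne_zero hF)
  have hsymm : LinearMap.IsSymm (Matrix.toBilin' A) := by
    refine ⟨fun x y => ?_⟩
    rw [RingHom.id_apply, toBilin'_apply', toBilin'_apply', dotProduct_mulVec, ← mulVec_transpose,
      hA, dotProduct_comm]
  obtain ⟨v, hv⟩ := LinearMap.BilinForm.exists_orthogonal_basis hsymm
  have e : Fin (Module.finrank F (n → F)) ≃ n := Fintype.equivOfCardEq (by simp)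
  let v' := v.reindex e
  let P := (Pi.basisFun F n).toMatrix v'
  refine ⟨P, ?_, fun a => (Pᵀ * A * P) a a, ?_⟩
  · exact IsUnit.of_mul_eq_one _ ((Pi.basisFun F n).toMatrix_mul_toMatrix_flip v')
  · ext a b
    rcases eq_or_ne a b with rfl | hab
    · rw [diagonal_apply_eq]
    · rw [diagonal_apply_ne _ hab]
      have h : Matrix.toBilin' A (v (e.symm a)) (v (e.symm b)) = 0 :=
        hv (i := e.symm a) (j := e.symm b) (by simpa using hab)
      rw [toBilin'_apply', dotProduct_mulVec] at h
      rw [mul_apply]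
      have hP : ∀ c d, P c d = v (e.symm d) c := fun c d => by
        simp [P, v', Module.Basis.toMatrix_apply]
      simpa [dotProduct, vecMul, mul_apply, hP] using h

end SymmetricMatrix

section GaussSum

theorem addChar_sum_eq_prod {ι A R : Type*} [Fintype ι] [AddCommMonoid A] [CommMonoid R]
    (ψ : AddChar A R) (g : ι → A) : ψ (∑ a, g a) = ∏ a, ψ (g a) :=
  map_prod ψ.toMonoidHom (fun a => Multiplicative.ofAdd (g a)) univ

variable {F : Type} [Field F] [Fintype F] (χ : AddChar F ℂ)

/-- The Gauss sum of the quadratic form with Gram matrix `M`. -/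
noncomputable def quadGauss {n : Type*} [Fintype n] [DecidableEq n] (M : Matrix n n F) : ℂ :=
  ∑ x : n → F, χ (x ⬝ᵥ M *ᵥ x)

variable {n m : Type*} [Fintype n] [DecidableEq n] [Fintype m] [DecidableEq m]

theorem quadGauss_congr (M P : Matrix n n F) (hP : IsUnit P) :
    quadGauss χ (Pᵀ * M * P) = quadGauss χ M := by
  have hbij : Function.Bijective P.mulVec :=
    Finite.injective_iff_bijective.1 (mulVec_injective_iff_isUnit.2 hP)
  refine Fintype.sum_bijective _ hbij _ _ fun x => ?_
  rw [← mulVec_mulVec, ← mulVec_mulVec, dotProduct_mulVec, vecMul_transpose]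

theorem quadGauss_submatrix (M : Matrix n n F) (e : m ≃ n) :
    quadGauss χ (M.submatrix e e) = quadGauss χ M := by
  refine Fintype.sum_equiv (e.arrowCongr (Equiv.refl F)) _ _ fun x => ?_
  congr 1
  simp only [dotProduct, mulVec, submatrix_apply, Equiv.arrowCongr_apply, Equiv.coe_refl,
    Function.comp_apply, id_eq]
  rw [← e.sum_comp]
  refine sum_congr rfl fun a _ => ?_
  rw [← e.sum_comp]
  simp

theorem quadGauss_diagonal (w : n → F) :
    quadGauss χ (diagonal w) = ∏ a, ∑ t, χ (w a * t ^ 2) := by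
  rw [prod_univ_sum, Fintype.piFinset_univ]
  refine sum_congr rfl fun x _ => ?_
  rw [dotProduct, addChar_sum_eq_prod]
  refine prod_congr rfl fun a _ => ?_
  rw [mulVec_diagonal]
  ring_nf

theorem quadGauss_fromBlocks_zero (A : Matrix m m F) :
    quadGauss χ (fromBlocks A 0 0 (0 : Matrix n n F)) =
      quadGauss χ A * (Fintype.card F : ℂ) ^ Fintype.card n := by
  rw [quadGauss, ← (Equiv.sumArrowEquivProdArrow m n F).symm.sum_comp, Fintype.sum_prod_type]
  have h : ∀ (x : m → F) (y : n → F), (Equiv.sumArrowEquivProdArrow m n F).symm (x, y) =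
      Sum.elim x y := fun _ _ => rfl
  simp only [h, fromBlocks_mulVec, Sum.elim_comp_inl, Sum.elim_comp_inr, zero_mulVec, add_zero,
    sumElim_dotProduct_sumElim, dotProduct_zero, sum_const, card_univ, nsmul_eq_mul,
    Fintype.card_fun, ← mul_sum, quadGauss]
  push_cast
  ring

variable [DecidableEq F]

theorem sum_char_mul_sq (hF : ringChar F ≠ 2) (hχ : χ ≠ 1) {a : F} (ha : a ≠ 0) :
    ∑ t, χ (a * t ^ 2) = ((quadraticChar F a : ℤ) : ℂ) * gSum F χ := by
  have hprim := AddChar.IsPrimitive.of_ne_one hχ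
  have hη : ((quadraticChar F a : ℤ) : ℂ) ^ 2 = 1 := by
    exact_mod_cast quadraticChar_sq_one ha
  have h0 : ∑ t, χ (a * t) = 0 := by
    have := AddChar.sum_mulShift (ψ := χ) a hprim
    rw [if_neg ha] at this
    simpa [mul_comm] using this
  have h1 : gSum F χ =
      ((quadraticChar F a : ℤ) : ℂ) * ∑ t, ((quadraticChar F t : ℤ) : ℂ) * χ (a * t) := by
    rw [gSum, ← (mulLeft_bijective₀ a ha).sum_comp, mul_sum]
    simp only [map_mul, Int.cast_mul, mul_assoc]
  calc ∑ t, χ (a * t ^ 2) = ∑ s, ∑ t with t ^ 2 = s, χ (a * t ^ 2) :=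
        (sum_fiberwise _ _ _).symm
    _ = ∑ s, ((quadraticChar F s : ℤ) + 1 : ℂ) * χ (a * s) := by
        refine sum_congr rfl fun s _ => ?_
        have hs := quadraticChar_card_sqrts hF s
        rw [sum_congr rfl (g := fun _ => χ (a * s)) (by simp +contextual), sum_const,
          nsmul_eq_mul]
        congr 1
        have : ({x : F | x ^ 2 = s}.toFinset) = univ.filter fun t => t ^ 2 = s := by
          ext; simp
        rw [this] at hs
        exact_mod_cast hs
    _ = _ := by
        rw [h1, ← mul_assoc, ← sq, hη]
        simp [add_mul, sum_add_distrib, h0]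

theorem quadGauss_of_det_ne_zero (hF : ringChar F ≠ 2) (hχ : χ ≠ 1) (A : Matrix n n F)
    (hA : Aᵀ = A) (hdet : A.det ≠ 0) :
    quadGauss χ A = ((quadraticChar F A.det : ℤ) : ℂ) * gSum F χ ^ Fintype.card n := by
  obtain ⟨P, hP, w, hw⟩ := exists_transpose_mul_mul_eq_diagonal hF A hA
  have hP' : P.det ≠ 0 := ((isUnit_iff_isUnit_det P).1 hP).ne_zero
  have hprod : ∏ a, w a = P.det ^ 2 * A.det := by
    rw [← det_diagonal, ← hw, det_mul, det_mul, det_transpose]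
    ring
  have hne : ∀ a, w a ≠ 0 := fun a =>
    prod_ne_zero_iff.1 (hprod ▸ mul_ne_zero (pow_ne_zero 2 hP') hdet) a (mem_univ a)
  rw [← quadGauss_congr χ A P hP, hw, quadGauss_diagonal,
    prod_congr rfl fun a _ => sum_char_mul_sq χ hF hχ (hne a), prod_mul_distrib, prod_const,
    card_univ, ← Int.cast_prod, ← map_prod, hprod, map_mul, quadraticChar_sq_one' hP', one_mul]

theorem quadGauss_fromBlocks (hF : ringChar F ≠ 2) (hχ : χ ≠ 1) (A : Matrix m m F)
    (B : Matrix m n F) (D : Matrix n n F) (hA : Aᵀ = A) (hdet : A.det ≠ 0)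
    (hD : D = Bᵀ * A⁻¹ * B) :
    quadGauss χ (fromBlocks A B Bᵀ D) = ((quadraticChar F A.det : ℤ) : ℂ) *
      gSum F χ ^ Fintype.card m * (Fintype.card F : ℂ) ^ Fintype.card n := by
  let _ := A.invertibleOfIsUnitDet (isUnit_iff_ne_zero.2 hdet)
  have hU : IsUnit (fromBlocks 1 (⅟A * B) 0 1 : Matrix (m ⊕ n) (m ⊕ n) F) := by
    rw [isUnit_iff_isUnit_det, det_fromBlocks_zero₂₁]
    simp
  have hT : (fromBlocks 1 0 (Bᵀ * ⅟A) 1 : Matrix (m ⊕ n) (m ⊕ n) F) =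
      (fromBlocks 1 (⅟A * B) 0 1)ᵀ := by
    rw [fromBlocks_transpose, transpose_mul, invOf_eq_nonsing_inv, transpose_nonsing_inv, hA]
    simp
  rw [fromBlocks_eq_of_invertible₁₁, hT, quadGauss_congr χ _ _ hU, hD, ← invOf_eq_nonsing_inv,
    sub_self, quadGauss_fromBlocks_zero, quadGauss_of_det_ne_zero χ hF hχ A hA hdet]

theorem quadGauss_of_maximal_minor (hF : ringChar F ≠ 2) (hχ : χ ≠ 1) (M : Matrix n n F)
    (hM : Mᵀ = M) (W : Finset n)
    (hdet : det (M.submatrix (Subtype.val : {v // v ∉ W} → n) Subtype.val) ≠ 0)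
    (hmin : ∀ W' ⊂ W, det (M.submatrix (Subtype.val : {v // v ∉ W'} → n) Subtype.val) = 0) :
    quadGauss χ M =
      ((quadraticChar F (det (M.submatrix (Subtype.val : {v // v ∉ W} → n) Subtype.val)) : ℤ) : ℂ) *
        gSum F χ ^ (Fintype.card n - W.card) * (Fintype.card F : ℂ) ^ W.card := by
  let e : {v // v ∉ W} ⊕ {v // v ∈ W} ≃ n :=
    (Equiv.sumComm _ _).trans (Equiv.sumCompl fun v => v ∈ W)
  have hsub : ∀ {k l : Type _} (a : k → n) (b : l → n),
      (M.submatrix a b)ᵀ = M.submatrix b a := fun a b => by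
    rw [transpose_submatrix, hM]
  set A := M.submatrix (Subtype.val : {v // v ∉ W} → n) Subtype.val with hA
  set B := M.submatrix (Subtype.val : {v // v ∉ W} → n) (Subtype.val : {v // v ∈ W} → n) with hB
  set D := M.submatrix (Subtype.val : {v // v ∈ W} → n) Subtype.val with hD
  have hblocks : M.submatrix e e = fromBlocks A B Bᵀ D := by
    rw [hB, hsub]
    ext (a | a) (b | b) <;> rfl
  have hschur : D = Bᵀ * A⁻¹ * B := by
    refine schur_eq_zero A B D (hsub _ _) (hsub _ _) hdet fun k g hg => ?_
    rw [← hblocks, submatrix_submatrix]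
    set h : {v // v ∉ W} ⊕ Fin (k + 1) → n := e ∘ Sum.map id g
    have hinj : Function.Injective h :=
      e.injective.comp (Sum.map_injective.2 ⟨Function.injective_id, hg⟩)
    let W' : Finset n := univ \ univ.image h
    have hW' : ∀ v, v ∉ W' ↔ v ∈ Set.range h := by
      intro v
      rw [mem_sdiff, not_and_not_right, mem_image_univ_iff_mem_range]
      exact forall_prop_of_true (mem_univ v)
    let φ : {v // v ∉ W} ⊕ Fin (k + 1) ≃ {v // v ∉ W'} :=
      (Equiv.ofInjective h hinj).trans (Equiv.subtypeEquivRight fun v => (hW' v).symm)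
    have hφ : h = Subtype.val ∘ φ := rfl
    rw [hφ, ← submatrix_submatrix, det_submatrix_equiv_self]
    refine hmin W' (ssubset_iff_of_subset (fun v hv => ?_) |>.2 ⟨(g 0).1, (g 0).2, ?_⟩)
    · by_contra hvW
      exact (hW' v).2 ⟨Sum.inl ⟨v, hvW⟩, rfl⟩ hv
    · exact (hW' _).2 ⟨Sum.inr 0, rfl⟩
  rw [← quadGauss_submatrix χ M e, hblocks,
    quadGauss_fromBlocks χ hF hχ A B D (hsub _ _) hdet hschur, Fintype.card_coe,
    Fintype.card_subtype_compl, Fintype.card_coe]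

end GaussSum

section Flows

variable {V E F : Type} [Fintype V] [Fintype E] [DecidableEq V] [DecidableEq E] [Field F]
  [Fintype F] [DecidableEq F]

theorem sum_char_dotProduct {χ : AddChar F ℂ} (hχ : χ ≠ 1) (c : V → F) :
    ∑ x : V → F, χ (∑ v, x v * c v) =
      if c = 0 then (Fintype.card F : ℂ) ^ Fintype.card V else 0 := by
  have hprim := AddChar.IsPrimitive.of_ne_one hχ
  have h : ∑ x : V → F, χ (∑ v, x v * c v) = ∏ v, ∑ t, χ (t * c v) := by
    rw [prod_univ_sum, Fintype.piFinset_univ]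
    exact sum_congr rfl fun x _ => addChar_sum_eq_prod _ _
  rw [h, prod_congr rfl fun v _ => AddChar.sum_mulShift (c v) hprim]
  split_ifs with hc
  · simp [hc]
  · obtain ⟨v, hv⟩ := Function.ne_iff.1 hc
    exact prod_eq_zero (mem_univ v) (by simpa using hv)

theorem sum_units_char_mul_sq (χ : AddChar F ℂ) (t : F) :
    ∑ k : Fˣ, χ (k * t ^ 2) = ∑ k : Fˣ, χ (k * t) := by
  rcases eq_or_ne t 0 with rfl | ht
  · simp
  · refine Fintype.sum_equiv (Equiv.mulRight (Units.mk0 t ht)) _ _ fun k => ?_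
    simp [sq, mul_assoc]

theorem flowCount_eq_sum_units (i f : E → V) :
    (flowCount F i f : ℂ) = ∑ k : E → Fˣ,
      if (fun v => ∑ e, eps i f v e * (k e : F)) = 0 then 1 else 0 := by
  classical
  rw [sum_boole, flowCount, ← Fintype.card_subtype, ← Nat.card_eq_fintype_card]
  congr 1
  refine Nat.card_congr
    { toFun := fun k => ⟨fun e => Units.mk0 (k.1 e) (k.2.1 e), funext k.2.2⟩
      invFun := fun k => ⟨fun e => k.1 e, fun e => (k.1 e).ne_zero, congrFun k.2⟩
      left_inv := fun k => rfl
      right_inv := fun k => by ext; rfl }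

theorem flowCount_mul_card_pow {χ : AddChar F ℂ} (hχ : χ ≠ 1) (i f : E → V) :
    (flowCount F i f : ℂ) * (Fintype.card F : ℂ) ^ Fintype.card V =
      ∑ α : E → Fˣ, quadGauss χ (laplacian i f fun e => (α e : F)) := by
  have hexp : ∀ t : E → F, ∑ k : E → Fˣ, χ (∑ e, k e * t e) = ∏ e, ∑ k : Fˣ, χ (k * t e) := by
    intro t
    rw [prod_univ_sum, Fintype.piFinset_univ]
    exact sum_congr rfl fun k _ => addChar_sum_eq_prod _ _
  calc (flowCount F i f : ℂ) * (Fintype.card F : ℂ) ^ Fintype.card V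
      = ∑ k : E → Fˣ, ∑ x : V → F, χ (∑ v, x v * ∑ e, eps i f v e * (k e : F)) := by
        rw [flowCount_eq_sum_units, sum_mul]
        refine sum_congr rfl fun k _ => ?_
        rw [sum_char_dotProduct hχ]
        simp
    _ = ∑ x : V → F, ∑ k : E → Fˣ, χ (∑ e, k e * ∑ v, x v * eps i f v e) := by
        rw [sum_comm]
        refine sum_congr rfl fun x _ => sum_congr rfl fun k _ => congrArg χ ?_
        simp only [mul_sum]
        rw [sum_comm]
        exact sum_congr rfl fun e _ => sum_congr rfl fun v _ => by ring
    _ = ∑ x : V → F, ∑ k : E → Fˣ, χ (∑ e, k e * (∑ v, x v * eps i f v e) ^ 2) := by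
        simp only [hexp, sum_units_char_mul_sq]
    _ = _ := by
        rw [sum_comm]
        simp only [quadGauss, dotProduct_laplacian_mulVec]

end Flows

end FlowCount

/-- The main theorem: for a connected loopless multigraph `G` and a finite field `𝔽_q` of odd
characteristic, the number of nowhere-zero `𝔽_q`-flows equals
`∑_{α : E → 𝔽_q^*} η(s(α, G/W*(α))) · (g(q)/q)^{r*(G,α)}`, where `W*(α)` is a
minimum-cardinality nonempty vertex subset with `s(α, G/W*) ≠ 0` and
`r*(G,α) = |V| - |W*(α)|`. -/
theorem flowCount_eq_sum_quadraticChar_sContr {V E F : Type} [Fintype V] [Fintype E]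
    [DecidableEq V] [DecidableEq E] [Field F] [Fintype F] [DecidableEq F]
    (hF : ringChar F ≠ 2)
    (i f : E → V) (hl : ∀ e : E, i e ≠ f e)
    (hconn : ∀ u v : V, Connects i f Finset.univ u v)
    (χ₁ : AddChar F ℂ) (hχ : ∃ x : F, χ₁ x ≠ 1)
    (Wstar : (E → Fˣ) → Finset V)
    (hW : ∀ α : E → Fˣ, (Wstar α).Nonempty ∧
      sContr i f (Wstar α) (fun e => (α e : F)) ≠ 0 ∧
      ∀ W : Finset V, W.Nonempty → sContr i f W (fun e => (α e : F)) ≠ 0 →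
        (Wstar α).card ≤ W.card) :
    (flowCount F i f : ℂ) =
      ∑ α : E → Fˣ,
        ((quadraticChar F (sContr i f (Wstar α) (fun e => (α e : F))) : ℤ) : ℂ) *
          (gSum F χ₁ / (Fintype.card F : ℂ)) ^ (Fintype.card V - (Wstar α).card) := by
  have hχ' : χ₁ ≠ 1 := by
    rintro rfl
    obtain ⟨x, hx⟩ := hχ
    exact hx (AddChar.one_apply x)
  have hq : (Fintype.card F : ℂ) ≠ 0 := Nat.cast_ne_zero.2 Fintype.card_ne_zero
  rw [← mul_left_inj' (pow_ne_zero (Fintype.card V) hq), FlowCount.flowCount_mul_card_pow hχ',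
    Finset.sum_mul]
  refine Finset.sum_congr rfl fun α _ => ?_
  obtain ⟨⟨v, -⟩, hne, hmin⟩ := hW α
  have : Nonempty V := ⟨v⟩
  rw [FlowCount.sContr_eq_det hl] at hne
  rw [FlowCount.quadGauss_of_maximal_minor χ₁ hF hχ' _ (FlowCount.transpose_laplacian i f _)
      (Wstar α) hne fun W' hW' => ?_, FlowCount.sContr_eq_det hl, div_pow, mul_assoc, mul_assoc]
  · congr 1
    rw [div_mul_eq_mul_div, eq_div_iff (pow_ne_zero _ hq), mul_assoc, ← pow_add,
      Nat.add_sub_cancel' (Finset.card_le_univ _)]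
  · by_contra h
    rcases W'.eq_empty_or_nonempty with rfl | hn
    · refine h ?_
      rw [← FlowCount.det_laplacian_eq_zero hl fun e => (α e : F)]
      exact Matrix.det_submatrix_equiv_self
        (Equiv.subtypeUnivEquiv fun v => Finset.notMem_empty v) _
    · rw [← FlowCount.sContr_eq_det hl] at h
      exact (Finset.card_lt_card hW').not_ge (hmin W' hn h)
end

section
/- Let G be a connected loopless multigraph and q odd. Then F_G(q) = Σ_{α : E(G) → 𝔽_q^*} η(det L_r(G,α)) · (g(q)/q)^{r(α)}, where r(α) is the rank of the weighted Laplacian L(G,α) over 𝔽_q, and det L_r(G,α) is any nonzero principal minor of order r(α) (the value η(det L_r) is independent of the choice). -/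
theorem addChar_map_sum {ι A R : Type*} [AddCommMonoid A] [CommMonoid R]
    (χ : AddChar A R) (s : Finset ι) (g : ι → A) : χ (∑ j ∈ s, g j) = ∏ j ∈ s, χ (g j) := by
  classical
  induction s using Finset.induction_on with
  | empty => simp
  | insert a s ha ih => rw [Finset.sum_insert ha, Finset.prod_insert ha, χ.map_add_eq_mul, ih]

theorem sum_addChar_pi {ι A B R : Type*} [Fintype ι] [DecidableEq ι] [AddCommMonoid A] [Fintype B]
    [CommRing R] (χ : AddChar A R) (g : ι → B → A) :
    ∑ x : ι → B, χ (∑ j, g j (x j)) = ∏ j, ∑ t : B, χ (g j t) := by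
  rw [Fintype.prod_sum]
  exact Finset.sum_congr rfl fun x _ => addChar_map_sum χ _ _

theorem sum_units_addChar {F : Type} [Field F] [Fintype F] [DecidableEq F] {χ : AddChar F ℂ}
    (hχ : χ.IsPrimitive) (b : F) :
    ∑ a : Fˣ, χ (a * b) = (if b = 0 then (Fintype.card F : ℂ) else 0) - 1 := by
  have h := AddChar.sum_mulShift b hχ
  have h2 : ∑ x : F, χ (x * b) = χ (0 * b) + ∑ x ∈ Finset.univ.erase (0 : F), χ (x * b) :=
    (Finset.add_sum_erase _ _ (Finset.mem_univ 0)).symm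
  have h3 : ∑ a : Fˣ, χ (a * b) = ∑ x ∈ Finset.univ.erase (0 : F), χ (x * b) := by
    refine Finset.sum_bij (fun a _ => (a : F)) (fun a _ => by simp)
      (fun a _ b _ hab => Units.ext hab) (fun x hx => ?_) (fun _ _ => rfl)
    exact ⟨Units.mk0 x (by simpa using hx), Finset.mem_univ _, rfl⟩
  rw [h3]
  rw [h2] at h
  simp only [zero_mul, AddChar.map_zero_eq_one] at h
  rw [eq_sub_iff_add_eq, add_comm, h]
  split_ifs <;> simp

theorem sum_addChar_mul_sq {F : Type} [Field F] [Fintype F] [DecidableEq F]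
    (hF : ringChar F ≠ 2) {χ : AddChar F ℂ} (hχ : χ.IsPrimitive) {d : F} (hd : d ≠ 0) :
    ∑ y : F, χ (d * y ^ 2) = ((quadraticChar F d : ℤ) : ℂ) * gSum F χ := by
  have h1 : ∑ y : F, χ (d * y ^ 2) =
      ∑ t : F, (((quadraticChar F t : ℤ) : ℂ) + 1) * χ (d * t) := by
    rw [← Finset.sum_fiberwise (s := Finset.univ) (fun y : F => y ^ 2)]
    refine Finset.sum_congr rfl fun t _ => ?_
    rw [Finset.sum_congr rfl (g := fun _ => χ (d * t))
      (fun y hy => by rw [(Finset.mem_filter.1 hy).2]), Finset.sum_const, nsmul_eq_mul]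
    congr 1
    have := quadraticChar_card_sqrts hF t
    rw [Set.toFinset_ofPred] at this
    exact_mod_cast congrArg (fun z : ℤ => (z : ℂ)) this
  have h2 : ∑ t : F, χ (d * t) = 0 := by
    have := AddChar.sum_mulShift d hχ
    simpa [hd, mul_comm] using this
  rw [h1]
  simp only [add_mul, one_mul, Finset.sum_add_distrib, h2, add_zero]
  rw [gSum, Finset.mul_sum]
  refine Fintype.sum_equiv (Equiv.mulLeft₀ d hd) _ _ fun t => ?_
  have h3 : quadraticChar F d * quadraticChar F d = 1 := by
    rw [← pow_two, quadraticChar_sq_one hd]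
  rw [show Equiv.mulLeft₀ d hd t = d * t from rfl, map_mul (quadraticChar F), ← mul_assoc, ← Int.cast_mul,
    ← mul_assoc, h3, one_mul]

theorem Matrix.IsSymm.exists_transpose_mul_mul_eq_diagonal {n K : Type*} [Fintype n]
    [DecidableEq n] [Field K] (h2 : (2 : K) ≠ 0) {A : Matrix n n K} (hA : A.IsSymm) :
    ∃ (P : Matrix n n K) (d : n → K), IsUnit P ∧ P.transpose * A * P = Matrix.diagonal d := by
  have := invertibleOfNonzero h2
  have hB : (Matrix.toBilin' A).IsSymm := by
    refine ⟨fun x y => ?_⟩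
    rw [Matrix.toBilin'_apply', Matrix.toBilin'_apply', dotProduct_comm, ← Matrix.vecMul_transpose,
      hA.eq, ← Matrix.dotProduct_mulVec]
  obtain ⟨v, hv⟩ := LinearMap.BilinForm.exists_orthogonal_basis
    (LinearMap.BilinForm.isSymm_iff.1 hB)
  have hc : Fintype.card (Fin (Module.finrank K (n → K))) = Fintype.card n := by simp
  let w := v.reindex (Fintype.equivOfCardEq hc)
  refine ⟨Matrix.of fun a b => w b a, fun a => Matrix.toBilin' A (w a) (w a), ?_, ?_⟩
  · have : (Matrix.of fun a b => w b a) = (Pi.basisFun K n).toMatrix w := by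
      ext a b; simp [Module.Basis.toMatrix_apply]
    rw [this]
    let := (Pi.basisFun K n).invertibleToMatrix w
    exact isUnit_of_invertible _
  · ext a b
    have h : ((Matrix.of fun a b => w b a).transpose * A * (Matrix.of fun a b => w b a)) a b =
        Matrix.toBilin' A (w a) (w b) := by
      rw [Matrix.toBilin'_apply', Matrix.mul_assoc, Matrix.mul_apply']
      rfl
    rw [h]
    by_cases hab : a = b
    · subst hab; simp
    · rw [Matrix.diagonal_apply_ne _ hab]
      simp only [w, Module.Basis.reindex_apply]
      exact hv (fun h => hab ((Equiv.injective _) h))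

theorem sum_addChar_quadraticForm {n F : Type} [Fintype n] [DecidableEq n] [Field F] [Fintype F]
    [DecidableEq F] (hF : ringChar F ≠ 2) {χ : AddChar F ℂ} (hχ : χ.IsPrimitive)
    {A : Matrix n n F} (hA : A.IsSymm) (hdet : A.det ≠ 0) :
    ∑ x : n → F, χ (x ⬝ᵥ A.mulVec x) =
      ((quadraticChar F A.det : ℤ) : ℂ) * gSum F χ ^ Fintype.card n := by
  obtain ⟨P, d, hP, hd⟩ := hA.exists_transpose_mul_mul_eq_diagonal (Ring.two_ne_zero hF)
  have hPdet : P.det ≠ 0 := ((Matrix.isUnit_iff_isUnit_det P).1 hP).ne_zero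
  have hprod : ∏ j, d j = A.det * P.det ^ 2 := by
    rw [← Matrix.det_diagonal, ← hd, Matrix.det_mul, Matrix.det_mul, Matrix.det_transpose]
    ring
  have hd0 : ∀ j, d j ≠ 0 := fun j => by
    have : ∏ j, d j ≠ 0 := by rw [hprod]; exact mul_ne_zero hdet (pow_ne_zero _ hPdet)
    exact Finset.prod_ne_zero_iff.1 this j (Finset.mem_univ j)
  have hbij : Function.Bijective P.mulVec :=
    ⟨Matrix.mulVec_injective_iff_isUnit.2 hP, Matrix.mulVec_surjective_iff_isUnit.2 hP⟩
  have h1 : ∑ x : n → F, χ (x ⬝ᵥ A.mulVec x) = ∑ x : n → F, χ (∑ j, d j * x j ^ 2) := by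
    refine (Fintype.sum_bijective _ hbij _ _ fun x => ?_).symm
    congr 1
    have : P.mulVec x ⬝ᵥ A.mulVec (P.mulVec x) = x ⬝ᵥ (Matrix.diagonal d).mulVec x := by
      rw [← hd, ← Matrix.mulVec_mulVec, ← Matrix.mulVec_mulVec, Matrix.dotProduct_mulVec x,
        Matrix.vecMul_transpose]
    rw [this, dotProduct]
    refine Finset.sum_congr rfl fun j _ => ?_
    rw [Matrix.mulVec_diagonal]; ring
  rw [h1, sum_addChar_pi χ (fun j t => d j * t ^ 2),
    Finset.prod_congr rfl (fun j _ => sum_addChar_mul_sq hF hχ (hd0 j)), Finset.prod_mul_distrib,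
    Finset.prod_const, Finset.card_univ, ← Int.cast_prod, ← map_prod, hprod, map_mul,
    quadraticChar_sq_one' hPdet, mul_one]

theorem sum_addChar_quadraticForm_of_rank {n F : Type} [Fintype n] [DecidableEq n] [Field F]
    [Fintype F] [DecidableEq F] (hF : ringChar F ≠ 2) {χ : AddChar F ℂ} (hχ : χ.IsPrimitive)
    {M : Matrix n n F} (hM : M.IsSymm) {S : Finset n} (hS : S.card = M.rank)
    (hdet : (M.submatrix (fun a : {v // v ∈ S} => (a : n)) (fun a : {v // v ∈ S} => (a : n))).det ≠ 0) :
    ∑ x : n → F, χ (x ⬝ᵥ M.mulVec x) =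
      ((quadraticChar F
        (M.submatrix (fun a : {v // v ∈ S} => (a : n)) (fun a : {v // v ∈ S} => (a : n))).det : ℤ) : ℂ) *
        (gSum F χ / Fintype.card F) ^ M.rank * (Fintype.card F : ℂ) ^ Fintype.card n := by
  set A := M.submatrix (fun a : {v // v ∈ S} => (a : n)) (fun a : {v // v ∈ S} => (a : n))
  let K := LinearMap.ker M.mulVecLin
  let : Fintype K := Fintype.ofFinite K
  let ext : ({v // v ∈ S} → F) →ₗ[F] (n → F) := Function.ExtendByZero.linearMap F Subtype.val
  have hext : ∀ y (a : {v // v ∈ S}), ext y a = y a := fun y a =>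
    Subtype.val_injective.extend_apply _ _ _
  have hext0 : ∀ y a, a ∉ S → ext y a = 0 := fun y a ha =>
    Function.extend_apply' _ _ _ (by rintro ⟨b, rfl⟩; exact ha b.2)
  have hsum : ∀ y (g : n → F), ext y ⬝ᵥ g = y ⬝ᵥ fun a => g a := fun y g => by
    rw [dotProduct, dotProduct, ← Finset.sum_subset (Finset.subset_univ S)
      (fun a _ ha => by rw [hext0 y a ha, zero_mul]), ← Finset.sum_coe_sort]
    exact Finset.sum_congr rfl fun a _ => by rw [hext]
  have hres : ∀ y (a : {v // v ∈ S}), M.mulVec (ext y) a = A.mulVec y a := fun y a => by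
    rw [Matrix.mulVec, dotProduct_comm, hsum, dotProduct_comm]; rfl
  have hAinj : Function.Injective A.mulVec :=
    Matrix.mulVec_injective_iff_isUnit.2
      ((Matrix.isUnit_iff_isUnit_det A).2 (isUnit_iff_ne_zero.2 hdet))
  let φ : ({v // v ∈ S} → F) × K → (n → F) := fun p => ext p.1 + p.2
  have hker : ∀ k : K, M.mulVec (k : n → F) = 0 := fun k => k.2
  have hmul : ∀ p, M.mulVec (φ p) = M.mulVec (ext p.1) := fun p => by
    simp only [φ, Matrix.mulVec_add, hker, add_zero]
  have hinj : Function.Injective φ := by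
    rintro ⟨y, k⟩ ⟨y', k'⟩ h
    have h1 : y = y' := hAinj (funext fun a => by
      rw [← hres, ← hres, ← hmul (y, k), ← hmul (y', k'), h])
    subst h1
    simpa [φ] using h
  have hrn : M.rank + Module.finrank F K = Fintype.card n := by
    rw [Matrix.rank, LinearMap.finrank_range_add_finrank_ker, Module.finrank_fintype_fun_eq_card]
  have hKc : Fintype.card K = Fintype.card F ^ Module.finrank F K := Module.card_eq_pow_finrank
  have hcard : Fintype.card (({v // v ∈ S} → F) × K) = Fintype.card (n → F) := by
    rw [Fintype.card_prod, hKc, Fintype.card_fun, Fintype.card_fun, Fintype.card_coe, hS, ← pow_add,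
      hrn]
  have hbij : Function.Bijective φ := (Fintype.bijective_iff_injective_and_card φ).2 ⟨hinj, hcard⟩
  have hval : ∀ p, φ p ⬝ᵥ M.mulVec (φ p) = p.1 ⬝ᵥ A.mulVec p.1 := fun p => by
    rw [Matrix.dotProduct_mulVec, ← Matrix.mulVec_transpose, hM.eq, hmul, dotProduct_comm]
    simp only [φ]
    rw [add_dotProduct, Matrix.dotProduct_mulVec (p.2 : n → F), ← Matrix.mulVec_transpose, hM.eq,
      hker, zero_dotProduct, add_zero, hsum]
    exact congrArg _ (funext fun a => hres _ _)
  rw [← Fintype.sum_bijective φ hbij (fun p => χ (p.1 ⬝ᵥ A.mulVec p.1)) _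
    (fun p => by rw [hval]), Fintype.sum_prod_type]
  simp only [Finset.sum_const, Finset.card_univ, nsmul_eq_mul]
  rw [← Finset.mul_sum, sum_addChar_quadraticForm hF hχ (hM.submatrix _) hdet, hKc,
    Fintype.card_coe, hS, ← hrn, pow_add, div_pow]
  have hq : (Fintype.card F : ℂ) ≠ 0 := by exact_mod_cast Fintype.card_ne_zero
  push_cast
  field_simp
  rw [mul_comm]

theorem sum_eps_mul {V E R : Type} [Fintype V] [DecidableEq V] [CommRing R] (i f : E → V) (e : E)
    (he : i e ≠ f e) (x : V → R) : ∑ v, eps i f v e * x v = x (f e) - x (i e) := by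
  have h : ∀ v, eps i f v e * x v =
      (if f e = v then x v else 0) - (if i e = v then x v else 0) := fun v => by
    unfold eps
    by_cases h1 : i e = v
    · have h2 : f e ≠ v := fun h => he (h1.trans h.symm)
      simp [h1, h2]
    · by_cases h2 : f e = v <;> simp [h1, h2]
  simp only [h, Finset.sum_sub_distrib, Finset.sum_ite_eq, Finset.mem_univ, if_true]

theorem Lap_apply_eq_sum {V E R : Type} [Fintype E] [DecidableEq V] [CommRing R] (i f : E → V)
    (hl : ∀ e, i e ≠ f e) (α : E → R) (k j : V) :
    Lap i f α k j = ∑ e, α e * eps i f k e * eps i f j e := by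
  unfold Lap
  split_ifs with hkj
  · subst hkj
    rw [Finset.sum_filter]
    refine Finset.sum_congr rfl fun e _ => ?_
    have := hl e
    unfold eps
    split_ifs <;> simp_all
  · rw [Finset.sum_filter, ← Finset.sum_neg_distrib]
    refine Finset.sum_congr rfl fun e _ => ?_
    have := hl e
    unfold eps
    split_ifs <;> simp_all

theorem Lap_isSymm {V E R : Type} [Fintype E] [DecidableEq V] [CommRing R] (i f : E → V)
    (hl : ∀ e, i e ≠ f e) (α : E → R) : (Lap i f α).IsSymm := by
  ext k j
  rw [Matrix.transpose_apply, Lap_apply_eq_sum i f hl, Lap_apply_eq_sum i f hl]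
  exact Finset.sum_congr rfl fun e _ => by ring

theorem dotProduct_Lap_mulVec {V E R : Type} [Fintype V] [Fintype E] [DecidableEq V] [CommRing R]
    (i f : E → V) (hl : ∀ e, i e ≠ f e) (α : E → R) (x : V → R) :
    x ⬝ᵥ (Lap i f α).mulVec x = ∑ e, α e * (x (f e) - x (i e)) ^ 2 := by
  simp only [dotProduct, Matrix.mulVec, Lap_apply_eq_sum i f hl, Finset.mul_sum, Finset.sum_mul]
  rw [Finset.sum_congr rfl fun k _ => Finset.sum_comm, Finset.sum_comm]
  refine Finset.sum_congr rfl fun e _ => ?_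
  rw [← sum_eps_mul i f e (hl e) x, pow_two, Finset.sum_mul_sum, Finset.mul_sum]
  refine Finset.sum_congr rfl fun k _ => ?_
  rw [Finset.mul_sum]
  exact Finset.sum_congr rfl fun j _ => by ring

theorem flowCount_mul_card_pow {V E F : Type} [Fintype V] [Fintype E] [DecidableEq V]
    [DecidableEq E] [Field F] [Fintype F] [DecidableEq F] (i f : E → V) (hl : ∀ e, i e ≠ f e)
    {χ : AddChar F ℂ} (hχ : χ.IsPrimitive) :
    (flowCount F i f : ℂ) * (Fintype.card F : ℂ) ^ Fintype.card V =
      ∑ x : V → F, ∏ e, ((if x (f e) - x (i e) = 0 then (Fintype.card F : ℂ) else 0) - 1) := by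
  have hcard : flowCount F i f =
      (Finset.univ.filter fun k : E → Fˣ => ∀ v, ∑ e, eps i f v e * (k e : F) = 0).card := by
    rw [flowCount, ← Fintype.card_subtype, ← Nat.card_eq_fintype_card]
    exact Nat.card_congr
      { toFun := fun k => ⟨fun e => Units.mk0 (k.1 e) (k.2.1 e), k.2.2⟩
        invFun := fun k => ⟨fun e => k.1 e, fun e => (k.1 e).ne_zero, k.2⟩
        left_inv := fun k => rfl
        right_inv := fun k => Subtype.ext (funext fun e => Units.ext rfl) }
  have horth : ∀ c : V → F, ∑ x : V → F, χ (∑ v, x v * c v) =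
      if ∀ v, c v = 0 then (Fintype.card F : ℂ) ^ Fintype.card V else 0 := fun c => by
    rw [sum_addChar_pi χ (fun v t => t * c v)]
    simp only [AddChar.sum_mulShift _ hχ]
    split_ifs with h
    · simp [h]
    · push Not at h
      obtain ⟨v, hv⟩ := h
      exact Finset.prod_eq_zero (Finset.mem_univ v) (by simp [hv])
  rw [hcard, Finset.card_filter, Nat.cast_sum, Finset.sum_mul]
  have h1 : ∀ k : E → Fˣ,
      (((if ∀ v, ∑ e, eps i f v e * (k e : F) = 0 then 1 else 0 : ℕ) : ℂ) *
        (Fintype.card F : ℂ) ^ Fintype.card V) =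
      ∑ x : V → F, χ (∑ e, k e * (x (f e) - x (i e))) := fun k => by
    rw [Nat.cast_ite, Nat.cast_one, Nat.cast_zero, ite_mul, one_mul, zero_mul, ← horth]
    refine Finset.sum_congr rfl fun x _ => congrArg χ ?_
    simp only [← sum_eps_mul i f _ (hl _) x, Finset.mul_sum]
    rw [Finset.sum_comm]
    exact Finset.sum_congr rfl fun e _ => Finset.sum_congr rfl fun v _ => by ring
  simp only [h1]
  rw [Finset.sum_comm]
  refine Finset.sum_congr rfl fun x _ => ?_
  rw [sum_addChar_pi χ (fun e (t : Fˣ) => (t : F) * (x (f e) - x (i e)))]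
  simp only [sum_units_addChar hχ]

/-- Formula (main), rank form: `F_G(q) = ∑_α η(det L_r(G,α)) (g(q)/q)^{r(α)}`, where `r(α)` is
the rank of the weighted Laplacian over `𝔽_q` and `det L_r(G,α)` is any nonzero principal
minor of order `r(α)`. -/
theorem flowCount_eq_sum_quadraticChar_minor {V E F : Type} [Fintype V] [Fintype E]
    [DecidableEq V] [DecidableEq E] [Field F] [Fintype F] [DecidableEq F]
    (hF : ringChar F ≠ 2)
    (i f : E → V) (hl : ∀ e : E, i e ≠ f e)
    (hconn : ∀ u v : V, Connects i f Finset.univ u v)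
    (χ₁ : AddChar F ℂ) (hχ : ∃ x : F, χ₁ x ≠ 1)
    (S : (E → Fˣ) → Finset V)
    (hS : ∀ α : E → Fˣ, (S α).card = (Lap i f (fun e => ((α e : F)))).rank ∧
      ((Lap i f (fun e => ((α e : F)))).submatrix
        (fun a : {v : V // v ∈ S α} => (a : V))
        (fun a : {v : V // v ∈ S α} => (a : V))).det ≠ 0) :
    (flowCount F i f : ℂ) =
      ∑ α : E → Fˣ,
        ((quadraticChar F (((Lap i f (fun e => ((α e : F)))).submatrix
            (fun a : {v : V // v ∈ S α} => (a : V))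
            (fun a : {v : V // v ∈ S α} => (a : V))).det) : ℤ) : ℂ) *
          (gSum F χ₁ / (Fintype.card F : ℂ)) ^ (Lap i f (fun e => ((α e : F)))).rank := by
  have hχp : χ₁.IsPrimitive := AddChar.IsPrimitive.of_ne_one (AddChar.ne_one_iff.2 hχ)
  have hq : (Fintype.card F : ℂ) ^ Fintype.card V ≠ 0 :=
    pow_ne_zero _ (by exact_mod_cast Fintype.card_ne_zero)
  refine mul_right_cancel₀ hq ?_
  rw [flowCount_mul_card_pow i f hl hχp, Finset.sum_mul]
  simp only [← sum_addChar_quadraticForm_of_rank hF hχp (Lap_isSymm i f hl _) (hS _).1 (hS _).2,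
    dotProduct_Lap_mulVec i f hl]
  rw [Finset.sum_comm]
  refine Finset.sum_congr rfl fun x _ => ?_
  rw [sum_addChar_pi χ₁ (fun e (t : Fˣ) => (t : F) * (x (f e) - x (i e)) ^ 2)]
  simp only [sum_units_addChar hχp, sq_eq_zero_iff]
end
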